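/- Let W be a channel with arbitrary input alphabet 𝒳 and finite output alphabet 𝒴, and let √X̃ = { (√(W_x(y)))_{y∈𝒴} : x ∈ 𝒳 } ⊆ ℝ^𝒴 with the Euclidean metric. Then for every λ₁, λ₂ > 0 with λ₁ + λ₂ < 1, (1/4) · d̲_M(√X̃) ≤ liminf_{n→∞} (1/(n log₂ n)) · log₂ N_DI(n,λ₁,λ₂) ≤ (1/2) · d̲_M(√X̃), where d̲_M denotes the lower Minkowski dimension. -/

import Mathlib

open Real Filter

namespace DIChannel

variable {X Y : Type*}

/-- `p` is a probability distribution on the finite alphabet `Y`. -/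
def IsDist [Fintype Y] (p : Y → ℝ) : Prop := (∀ y, 0 ≤ p y) ∧ ∑ y, p y = 1

/-- Product (memoryless) output distribution `W_{x^n}` on `Y^n`. -/
noncomputable def prodP [Fintype Y] (W : X → Y → ℝ) {n : ℕ} (u : Fin n → X)
    (y : Fin n → Y) : ℝ := ∏ i, W (u i) (y i)

/-- Probability of a set of output words under `W_{x^n}`. -/
noncomputable def probOf [Fintype Y] (W : X → Y → ℝ) {n : ℕ} (u : Fin n → X)
    (E : Finset (Fin n → Y)) : ℝ := ∑ y ∈ E, prodP W u y

/-- An `(n,N,λ₁,λ₂)`-deterministic identification code for the channel `W`. -/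
def diCode [Fintype Y] (W : X → Y → ℝ) (n N : ℕ) (l1 l2 : ℝ) : Prop :=
  ∃ (u : Fin N → Fin n → X) (E : Fin N → Finset (Fin n → Y)),
    (∀ j, 1 - l1 ≤ probOf W (u j) (E j)) ∧
    (∀ j k, j ≠ k → probOf W (u j) (E k) ≤ l2)

/-- The spherisation `√X̃ = {(√W_x(y))_y : x ∈ 𝒳} ⊆ ℝ^𝒴` of the output set, carrying the
Euclidean metric. -/
noncomputable def sqrtSet [Fintype Y] (W : X → Y → ℝ) : Set (EuclideanSpace ℝ Y) :=
  {v | ∃ x : X, ∀ y, v y = Real.sqrt (W x y)}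

/-- Covering number `Γ_δ(F)`: the minimal number of closed balls of radius `δ` with centers
in `F` whose union contains `F`; `⊤` if no finite such cover exists. -/
noncomputable def coverNum {α : Type*} [PseudoMetricSpace α] (F : Set α) (δ : ℝ) : ℕ∞ :=
  sInf {n : ℕ∞ | ∃ s : Finset α, ↑s ⊆ F ∧ (s.card : ℕ∞) = n ∧
    F ⊆ ⋃ x ∈ s, Metric.closedBall x δ}

/-- Packing number `Π_δ(F)`: the maximal number of pairwise disjoint open balls of radius `δ`
with centers in `F`. -/
noncomputable def packNum {α : Type*} [PseudoMetricSpace α] (F : Set α) (δ : ℝ) : ℕ∞ :=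
  sSup {n : ℕ∞ | ∃ s : Finset α, ↑s ⊆ F ∧ (s.card : ℕ∞) = n ∧
    (↑s : Set α).PairwiseDisjoint fun x => Metric.ball x δ}

/-- Lower Minkowski dimension `d̲_M(F) = liminf_{δ→0⁺} log Γ_δ(F)/(−log δ)`. -/
noncomputable def lowerMinkDim {α : Type*} [PseudoMetricSpace α] (F : Set α) : ℝ :=
  Filter.liminf (fun δ : ℝ => Real.log ((coverNum F δ).toNat : ℝ) / (-Real.log δ))
    (nhdsWithin 0 (Set.Ioi 0))

/-- Upper Minkowski dimension `d̄_M(F) = limsup_{δ→0⁺} log Γ_δ(F)/(−log δ)`. -/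
noncomputable def upperMinkDim {α : Type*} [PseudoMetricSpace α] (F : Set α) : ℝ :=
  Filter.limsup (fun δ : ℝ => Real.log ((coverNum F δ).toNat : ℝ) / (-Real.log δ))
    (nhdsWithin 0 (Set.Ioi 0))

end DIChannel


open DIChannel

namespace DIChannel

/-- The point of the spherisation belonging to the input `x`. -/
noncomputable def sv {X Y : Type*} [Fintype Y] (W : X → Y → ℝ) (x : X) : EuclideanSpace ℝ Y :=
  WithLp.toLp 2 (fun y => Real.sqrt (W x y))

/-- Bhattacharyya coefficient of two outputs. -/
noncomputable def bc {X Y : Type*} [Fintype Y] (W : X → Y → ℝ) (x x' : X) : ℝ :=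
  ∑ y, Real.sqrt (W x y) * Real.sqrt (W x' y)

lemma sqrtSet_eq {X Y : Type*} [Fintype Y] (W : X → Y → ℝ) : sqrtSet W = Set.range (sv W) := by
  ext v
  constructor
  · rintro ⟨x, hx⟩
    refine ⟨x, ?_⟩
    ext y
    simp [sv, hx]
  · rintro ⟨x, rfl⟩
    exact ⟨x, fun y => by simp [sv]⟩

lemma sv_dist_sq {X Y : Type*} [Fintype Y] (W : X → Y → ℝ) (x x' : X) :
    dist (sv W x) (sv W x') ^ 2 = ∑ y, (Real.sqrt (W x y) - Real.sqrt (W x' y)) ^ 2 := by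
  rw [EuclideanSpace.dist_eq, Real.sq_sqrt (Finset.sum_nonneg fun _ _ => sq_nonneg _)]
  refine Finset.sum_congr rfl fun y _ => ?_
  simp [sv, Real.dist_eq, sq_abs]

lemma bc_eq {X Y : Type*} [Fintype Y] (W : X → Y → ℝ) (hW : ∀ x, IsDist (W x)) (x x' : X) :
    bc W x x' = 1 - dist (sv W x) (sv W x') ^ 2 / 2 := by
  rw [sv_dist_sq]
  have h : ∀ y, (Real.sqrt (W x y) - Real.sqrt (W x' y)) ^ 2 =
      W x y + W x' y - 2 * (Real.sqrt (W x y) * Real.sqrt (W x' y)) := by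
    intro y
    have a1 := Real.sq_sqrt ((hW x).1 y)
    have a2 := Real.sq_sqrt ((hW x').1 y)
    nlinarith
  rw [Finset.sum_congr rfl fun y _ => h y, Finset.sum_sub_distrib, Finset.sum_add_distrib,
    (hW x).2, (hW x').2, ← Finset.mul_sum]
  unfold bc
  ring

lemma bc_nonneg {X Y : Type*} [Fintype Y] (W : X → Y → ℝ) (x x' : X) : 0 ≤ bc W x x' :=
  Finset.sum_nonneg fun _ _ => by positivity

lemma W_le_one {X Y : Type*} [Fintype Y] (W : X → Y → ℝ) (hW : ∀ x, IsDist (W x)) (x : X) (y : Y) :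
    W x y ≤ 1 := by
  rw [← (hW x).2]
  exact Finset.single_le_sum (fun y _ => (hW x).1 y) (Finset.mem_univ y)

lemma exists_max_sep {α : Type*} (S : Set α) (r : α → α → Prop) (B : ℕ)
    (hB : ∀ s : Finset α, ↑s ⊆ S → (∀ a ∈ s, ∀ b ∈ s, a ≠ b → r a b) → s.card ≤ B) :
    ∃ s : Finset α, ↑s ⊆ S ∧ (∀ a ∈ s, ∀ b ∈ s, a ≠ b → r a b) ∧
      ∀ x ∈ S, ∃ c ∈ s, c = x ∨ ¬ r c x ∨ ¬ r x c := by
  classical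
  let K : Set ℕ := {n | ∃ s : Finset α, ↑s ⊆ S ∧ (∀ a ∈ s, ∀ b ∈ s, a ≠ b → r a b) ∧ s.card = n}
  have hK : K.Nonempty := ⟨0, ∅, by simp⟩
  have hKb : BddAbove K := ⟨B, by rintro n ⟨s, h1, h2, rfl⟩; exact hB s h1 h2⟩
  obtain ⟨s, h1, h2, h3⟩ := Nat.sSup_mem hK hKb
  refine ⟨s, h1, h2, fun x hx => ?_⟩
  by_contra! hcon
  have hxs : x ∉ s := fun h => (hcon x h).1 rfl
  have : (insert x s).card ∈ K := by
    refine ⟨insert x s, ?_, ?_, rfl⟩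
    · intro a ha
      rcases Finset.mem_insert.1 (Finset.mem_coe.1 ha) with rfl | ha
      · exact hx
      · exact h1 ha
    · intro a ha b hb hab
      rcases Finset.mem_insert.1 ha with h5 | h5 <;> rcases Finset.mem_insert.1 hb with h6 | h6
      · exact absurd (h5.trans h6.symm) hab
      · rw [h5]; exact (hcon b h6).2.2
      · rw [h6]; exact (hcon a h5).2.1
      · exact h2 a h5 b h6 hab
  have h4 := le_csSup hKb this
  rw [Finset.card_insert_of_notMem hxs, ← h3] at h4
  omega

lemma grid_bound {X Y : Type*} [Fintype Y] (W : X → Y → ℝ) (hW : ∀ x, IsDist (W x))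
    (δ : ℝ) (hδ : 0 < δ) (s : Finset X)
    (hs : ∀ a ∈ s, ∀ b ∈ s, a ≠ b → δ < dist (sv W a) (sv W b)) :
    s.card ≤ (⌊(Fintype.card Y : ℝ) / δ⌋₊ + 1) ^ Fintype.card Y := by
  classical
  set M := ⌊(Fintype.card Y : ℝ) / δ⌋₊ with hM
  set D : ℝ := (Fintype.card Y : ℝ) with hD
  let φ : X → (Y → ℕ) := fun x y => ⌊Real.sqrt (W x y) * (D / δ)⌋₊
  have hD0 : 0 ≤ D := Nat.cast_nonneg _
  have hmaps : ∀ a ∈ s, φ a ∈ Fintype.piFinset (fun _ : Y => Finset.range (M + 1)) := by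
    intro a _
    rw [Fintype.mem_piFinset]
    intro y
    rw [Finset.mem_range, Nat.lt_succ_iff]
    apply Nat.floor_le_floor
    have : Real.sqrt (W a y) ≤ 1 := Real.sqrt_le_one.2 (W_le_one W hW a y)
    exact mul_le_of_le_one_left (by positivity) this
  have hinj : Set.InjOn φ (s : Set X) := by
    intro a ha b hb hab
    by_contra hne
    have h1 := hs a ha b hb hne
    have h2 : ∀ y, (Real.sqrt (W a y) - Real.sqrt (W b y)) ^ 2 ≤ (δ / D) ^ 2 := by
      intro y
      have hDpos : 0 < D := by
        have : Nonempty Y := ⟨y⟩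
        exact Nat.cast_pos.2 Fintype.card_pos
      have h3 : ⌊Real.sqrt (W a y) * (D / δ)⌋₊ = ⌊Real.sqrt (W b y) * (D / δ)⌋₊ := congrFun hab y
      have e1 := Nat.floor_le (show 0 ≤ Real.sqrt (W a y) * (D / δ) by positivity)
      have e2 := Nat.lt_floor_add_one (Real.sqrt (W a y) * (D / δ))
      have e3 := Nat.floor_le (show 0 ≤ Real.sqrt (W b y) * (D / δ) by positivity)
      have e4 := Nat.lt_floor_add_one (Real.sqrt (W b y) * (D / δ))
      rw [h3] at e1 e2
      have hk : |(Real.sqrt (W a y) - Real.sqrt (W b y)) * (D / δ)| ≤ 1 := by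
        rw [abs_le]
        constructor <;> linarith
      rw [abs_mul, abs_of_pos (show 0 < D / δ by positivity)] at hk
      have hk2 : |Real.sqrt (W a y) - Real.sqrt (W b y)| ≤ δ / D := by
        rw [le_div_iff₀ hDpos]
        have := mul_le_mul_of_nonneg_right hk hδ.le
        have e : |Real.sqrt (W a y) - Real.sqrt (W b y)| * (D / δ) * δ =
          |Real.sqrt (W a y) - Real.sqrt (W b y)| * D := by field_simp
        linarith
      rw [← sq_abs]
      gcongr
    have h3 : dist (sv W a) (sv W b) ^ 2 ≤ D * (δ / D) ^ 2 := by
      rw [sv_dist_sq]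
      refine (Finset.sum_le_sum fun y _ => h2 y).trans ?_
      simp [hD]
    have h4 : D * (δ / D) ^ 2 ≤ δ ^ 2 := by
      rcases Nat.eq_zero_or_pos (Fintype.card Y) with h0 | h0
      · simp [hD, h0]; positivity
      · have hD1 : 1 ≤ D := by rw [hD]; exact_mod_cast h0
        have : D * (δ / D) ^ 2 = δ ^ 2 / D := by field_simp
        rw [this]
        exact div_le_self (by positivity) hD1
    have h5 : δ ^ 2 < dist (sv W a) (sv W b) ^ 2 := by gcongr
    linarith
  have := Finset.card_le_card_of_injOn φ hmaps hinj
  simpa [Fintype.card_piFinset] using this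

lemma exists_sep {X Y : Type*} [Fintype Y] (W : X → Y → ℝ) (hW : ∀ x, IsDist (W x))
    (δ : ℝ) (hδ : 0 < δ) :
    ∃ A : Finset X, (∀ a ∈ A, ∀ b ∈ A, a ≠ b → δ < dist (sv W a) (sv W b)) ∧
      coverNum (sqrtSet W) δ ≤ A.card := by
  classical
  obtain ⟨s, -, h2, h3⟩ := exists_max_sep (Set.univ : Set X)
    (fun a b => δ < dist (sv W a) (sv W b)) _ (fun s _ hs => grid_bound W hW δ hδ s hs)
  refine ⟨s, h2, ?_⟩
  have h4 : coverNum (sqrtSet W) δ ≤ ((s.image (sv W)).card : ℕ∞) := by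
    apply sInf_le
    refine ⟨s.image (sv W), ?_, rfl, ?_⟩
    · rw [sqrtSet_eq]
      simp
    · rw [sqrtSet_eq]
      rintro _ ⟨x, rfl⟩
      obtain ⟨c, hc, h⟩ := h3 x trivial
      simp only [Set.mem_iUnion, Metric.mem_closedBall]
      refine ⟨sv W c, Finset.mem_image_of_mem _ hc, ?_⟩
      rcases h with rfl | h | h
      · simpa using hδ.le
      · rw [dist_comm]; exact not_lt.1 h
      · exact not_lt.1 h
  refine h4.trans ?_
  exact_mod_cast Finset.card_image_le

/-- The covering number as a natural number. -/
noncomputable def cn {X Y : Type*} [Fintype Y] (W : X → Y → ℝ) (δ : ℝ) : ℕ :=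
  (coverNum (sqrtSet W) δ).toNat

lemma coverNum_ne_top {X Y : Type*} [Fintype Y] (W : X → Y → ℝ) (hW : ∀ x, IsDist (W x))
    (δ : ℝ) (hδ : 0 < δ) : coverNum (sqrtSet W) δ ≠ ⊤ := by
  obtain ⟨A, _, h⟩ := exists_sep W hW δ hδ
  exact ne_top_of_le_ne_top (ENat.natCast_ne_top _) h

lemma cn_le_sep {X Y : Type*} [Fintype Y] (W : X → Y → ℝ) (hW : ∀ x, IsDist (W x))
    (δ : ℝ) (hδ : 0 < δ) :
    ∃ A : Finset X, (∀ a ∈ A, ∀ b ∈ A, a ≠ b → δ < dist (sv W a) (sv W b)) ∧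
      cn W δ ≤ A.card := by
  obtain ⟨A, h1, h⟩ := exists_sep W hW δ hδ
  exact ⟨A, h1, ENat.toNat_le_of_le_natCast h⟩

lemma cn_bound {X Y : Type*} [Fintype Y] (W : X → Y → ℝ) (hW : ∀ x, IsDist (W x))
    (δ : ℝ) (hδ : 0 < δ) :
    cn W δ ≤ (⌊(Fintype.card Y : ℝ) / δ⌋₊ + 1) ^ Fintype.card Y := by
  obtain ⟨A, h1, h⟩ := cn_le_sep W hW δ hδ
  exact h.trans (grid_bound W hW δ hδ A h1)

lemma cn_anti {X Y : Type*} [Fintype Y] (W : X → Y → ℝ) (hW : ∀ x, IsDist (W x))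
    (δ δ' : ℝ) (hδ : 0 < δ) (h : δ ≤ δ') : cn W δ' ≤ cn W δ := by
  apply ENat.toNat_le_toNat _ (coverNum_ne_top W hW δ hδ)
  apply sInf_le_sInf
  rintro n ⟨s, h1, h2, h3⟩
  refine ⟨s, h1, h2, h3.trans ?_⟩
  exact Set.iUnion₂_mono fun x _ => Metric.closedBall_subset_closedBall h

lemma cn_cover {X Y : Type*} [Fintype Y] (W : X → Y → ℝ) (hW : ∀ x, IsDist (W x))
    (δ : ℝ) (hδ : 0 < δ) : ∃ s : Finset (EuclideanSpace ℝ Y), s.card = cn W δ ∧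
      ∀ x, ∃ c ∈ s, dist (sv W x) c ≤ δ := by
  have hne : {n : ℕ∞ | ∃ s : Finset (EuclideanSpace ℝ Y), ↑s ⊆ sqrtSet W ∧ (s.card : ℕ∞) = n ∧
    sqrtSet W ⊆ ⋃ x ∈ s, Metric.closedBall x δ}.Nonempty := by
    by_contra hcon
    rw [Set.not_nonempty_iff_eq_empty] at hcon
    apply coverNum_ne_top W hW δ hδ
    unfold coverNum
    rw [hcon]; exact _root_.sInf_empty
  obtain ⟨s, h1, h2, h3⟩ := csInf_mem hne
  refine ⟨s, ?_, fun x => ?_⟩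
  · unfold cn coverNum
    rw [← h2]; simp
  · have : sv W x ∈ sqrtSet W := by rw [sqrtSet_eq]; exact ⟨x, rfl⟩
    have := h3 this
    simp only [Set.mem_iUnion, Metric.mem_closedBall] at this
    obtain ⟨c, hc, h⟩ := this
    exact ⟨c, hc, h⟩

lemma cn_pos {X Y : Type*} [Fintype Y] (W : X → Y → ℝ) (hW : ∀ x, IsDist (W x)) [Nonempty X]
    (δ : ℝ) (hδ : 0 < δ) : 1 ≤ cn W δ := by
  obtain ⟨s, h, h2⟩ := cn_cover W hW δ hδ
  obtain ⟨c, hc, _⟩ := h2 (Classical.arbitrary X)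
  rw [← h]
  exact Finset.card_pos.2 ⟨c, hc⟩


lemma sum_pi_prod {Y : Type*} [Fintype Y] {n : ℕ} (f : Fin n → Y → ℝ) :
    ∑ y : Fin n → Y, ∏ i, f i (y i) = ∏ i, ∑ y, f i y := by
  classical
  rw [Finset.prod_univ_sum, Fintype.piFinset_univ]

lemma prodP_nonneg {X Y : Type*} [Fintype Y] (W : X → Y → ℝ) (hW : ∀ x, IsDist (W x)) {n : ℕ}
    (u : Fin n → X) (y : Fin n → Y) : 0 ≤ prodP W u y :=
  Finset.prod_nonneg fun i _ => (hW (u i)).1 _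

lemma prodP_sum {X Y : Type*} [Fintype Y] (W : X → Y → ℝ) (hW : ∀ x, IsDist (W x)) {n : ℕ}
    (u : Fin n → X) : ∑ y, prodP W u y = 1 := by
  unfold prodP
  rw [sum_pi_prod (fun i => W (u i))]
  exact Finset.prod_eq_one fun i _ => (hW (u i)).2

lemma prodP_bc {X Y : Type*} [Fintype Y] (W : X → Y → ℝ) (hW : ∀ x, IsDist (W x)) {n : ℕ}
    (u v : Fin n → X) :
    ∑ y, Real.sqrt (prodP W u y) * Real.sqrt (prodP W v y) = ∏ i, bc W (u i) (v i) := by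
  unfold bc
  rw [← sum_pi_prod (fun i y => Real.sqrt (W (u i) y) * Real.sqrt (W (v i) y))]
  refine Finset.sum_congr rfl fun y _ => ?_
  unfold prodP
  rw [Real.sqrt_prod _ (fun i _ => (hW _).1 _), Real.sqrt_prod _ (fun i _ => (hW _).1 _),
    Finset.prod_mul_distrib]

lemma test_le {ι : Type*} [Fintype ι] (p q : ι → ℝ) (hp : ∀ i, 0 ≤ p i) (hq : ∀ i, 0 ≤ q i)
    (sp : ∑ i, p i = 1) (sq : ∑ i, q i = 1) (E : Finset ι) (b : ℝ)
    (hb : b = ∑ i, Real.sqrt (p i) * Real.sqrt (q i)) :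
    (∑ i ∈ E, p i - ∑ i ∈ E, q i) ^ 2 ≤ 8 * (1 - b) := by
  have h1 : ∑ i ∈ E, p i - ∑ i ∈ E, q i =
      ∑ i ∈ E, (Real.sqrt (p i) - Real.sqrt (q i)) * (Real.sqrt (p i) + Real.sqrt (q i)) := by
    rw [← Finset.sum_sub_distrib]
    refine Finset.sum_congr rfl fun i _ => ?_
    have a1 := Real.sq_sqrt (hp i)
    have a2 := Real.sq_sqrt (hq i)
    nlinarith
  have e1 : ∑ i, (Real.sqrt (p i) - Real.sqrt (q i)) ^ 2 = 2 - 2 * b := by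
    have : ∀ i, (Real.sqrt (p i) - Real.sqrt (q i)) ^ 2 =
        p i + q i - 2 * (Real.sqrt (p i) * Real.sqrt (q i)) := by
      intro i
      have a1 := Real.sq_sqrt (hp i)
      have a2 := Real.sq_sqrt (hq i)
      nlinarith
    rw [Finset.sum_congr rfl fun i _ => this i, Finset.sum_sub_distrib, Finset.sum_add_distrib,
      sp, sq, ← Finset.mul_sum, hb]
    ring
  have e2 : ∑ i, (Real.sqrt (p i) + Real.sqrt (q i)) ^ 2 ≤ 4 := by
    have : ∀ i, (Real.sqrt (p i) + Real.sqrt (q i)) ^ 2 ≤ 2 * p i + 2 * q i := by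
      intro i
      have a1 := Real.sq_sqrt (hp i)
      have a2 := Real.sq_sqrt (hq i)
      nlinarith [sq_nonneg (Real.sqrt (p i) - Real.sqrt (q i))]
    refine (Finset.sum_le_sum fun i _ => this i).trans ?_
    rw [Finset.sum_add_distrib, ← Finset.mul_sum, ← Finset.mul_sum, sp, sq]
    norm_num
  have f1 : ∑ i ∈ E, (Real.sqrt (p i) - Real.sqrt (q i)) ^ 2 ≤ 2 - 2 * b := by
    rw [← e1]
    exact Finset.sum_le_sum_of_subset_of_nonneg (Finset.subset_univ _) fun _ _ _ => sq_nonneg _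
  have f2 : ∑ i ∈ E, (Real.sqrt (p i) + Real.sqrt (q i)) ^ 2 ≤ 4 :=
    (Finset.sum_le_sum_of_subset_of_nonneg (Finset.subset_univ _) fun _ _ _ => sq_nonneg _).trans e2
  rw [h1]
  refine (Finset.sum_mul_sq_le_sq_mul_sq _ _ _).trans ?_
  have g1 : 0 ≤ ∑ i ∈ E, (Real.sqrt (p i) - Real.sqrt (q i)) ^ 2 :=
    Finset.sum_nonneg fun _ _ => sq_nonneg _
  have g2 : 0 ≤ ∑ i ∈ E, (Real.sqrt (p i) + Real.sqrt (q i)) ^ 2 :=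
    Finset.sum_nonneg fun _ _ => sq_nonneg _
  nlinarith [mul_le_mul f1 f2 g2 (g1.trans f1)]

lemma converse {X Y : Type*} [Fintype Y] (W : X → Y → ℝ) (hW : ∀ x, IsDist (W x))
    (l1 l2 : ℝ) (h1 : 0 < l1) (h2 : 0 < l2) (h12 : l1 + l2 < 1) (n m : ℕ) (hn : 1 ≤ n)
    (δ : ℝ) (hδ : 0 < δ) (hδn : 16 * n * δ ^ 2 < (1 - l1 - l2) ^ 2)
    (hc : diCode W n m l1 l2) : m ≤ cn W δ ^ n := by
  classical
  obtain ⟨u, E, hE1, hE2⟩ := hc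
  obtain ⟨s, hs, hcov⟩ := cn_cover W hW δ hδ
  choose c hcs hcd using hcov
  let φ : Fin m → (Fin n → s) := fun j i => ⟨c (u j i), hcs _⟩
  have hinj : Function.Injective φ := by
    intro j k hjk
    by_contra hne
    have hd : ∀ i, 1 - 2 * δ ^ 2 ≤ bc W (u j i) (u k i) := by
      intro i
      rw [bc_eq W hW]
      have e : c (u j i) = c (u k i) := congrArg Subtype.val (congrFun hjk i)
      have d1 := hcd (u j i)
      have d2 := hcd (u k i)
      rw [e] at d1
      have d3 := dist_triangle_right (sv W (u j i)) (sv W (u k i)) (c (u k i))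
      have d4 : dist (sv W (u j i)) (sv W (u k i)) ≤ 2 * δ := by linarith
      have d5 : dist (sv W (u j i)) (sv W (u k i)) ^ 2 ≤ (2 * δ) ^ 2 := by gcongr
      nlinarith
    have hn' : (1 : ℝ) ≤ n := by exact_mod_cast hn
    have hη : (1 - l1 - l2) ^ 2 ≤ 1 := by nlinarith
    have hδ1 : 16 * δ ^ 2 ≤ 1 := by nlinarith [sq_nonneg δ]
    have hbc : 1 - 2 * n * δ ^ 2 ≤ ∏ i, bc W (u j i) (u k i) := by
      calc 1 - 2 * n * δ ^ 2 = 1 + n * (-(2 * δ ^ 2)) := by ring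
        _ ≤ (1 + -(2 * δ ^ 2)) ^ n := one_add_mul_le_pow (by linarith) n
        _ = ∏ _i : Fin n, (1 - 2 * δ ^ 2) := by simp [sub_eq_add_neg]
        _ ≤ _ := Finset.prod_le_prod (fun _ _ => by linarith) fun i _ => hd i
    have ht := test_le (prodP W (u j)) (prodP W (u k)) (prodP_nonneg W hW _) (prodP_nonneg W hW _)
      (prodP_sum W hW _) (prodP_sum W hW _) (E j) _ (prodP_bc W hW (u j) (u k)).symm
    have t1 := hE1 j
    have t2 := hE2 k j (Ne.symm hne)
    unfold probOf at t1 t2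
    nlinarith
  have := Fintype.card_le_of_injective φ hinj
  simpa [hs] using this

/-- Self-information (negative entropy) mean. -/
noncomputable def negEnt {X Y : Type*} [Fintype Y] (W : X → Y → ℝ) (x : X) : ℝ :=
  ∑ y, W x y * Real.log (W x y)

lemma second_moment {X Y : Type*} [Fintype Y] (W : X → Y → ℝ) (hW : ∀ x, IsDist (W x))
    (g : X → Y → ℝ) (hg : ∀ x, ∑ y, W x y * g x y = 0) (V : ℝ)
    (hV : ∀ x, ∑ y, W x y * g x y ^ 2 ≤ V) (n : ℕ) : ∀ (u : Fin n → X) (a : ℝ),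
    ∑ y, prodP W u y * (a + ∑ i, g (u i) (y i)) ^ 2 ≤ a ^ 2 + n * V := by
  induction n with
  | zero => intro u a; simp [prodP]
  | succ n ih =>
    intro u a
    rw [← (Fin.consEquiv (fun _ => Y)).sum_comp, Fintype.sum_prod_type]
    simp only [Fin.consEquiv_apply, prodP, Fin.prod_univ_succ, Fin.sum_univ_succ, Fin.cons_zero,
      Fin.cons_succ]
    have step : ∀ y0, ∑ y : Fin n → Y, W (u 0) y0 * (∏ i, W (u i.succ) (y i)) *
        (a + (g (u 0) y0 + ∑ i : Fin n, g (u i.succ) (y i))) ^ 2 ≤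
        W (u 0) y0 * ((a + g (u 0) y0) ^ 2 + n * V) := by
      intro y0
      have := ih (fun i => u i.succ) (a + g (u 0) y0)
      simp only [prodP] at this
      refine le_trans (le_of_eq ?_) (mul_le_mul_of_nonneg_left this ((hW (u 0)).1 y0))
      rw [Finset.mul_sum]
      refine Finset.sum_congr rfl fun y _ => ?_
      ring
    refine (Finset.sum_le_sum fun y0 _ => step y0).trans ?_
    have e : ∀ y0, W (u 0) y0 * ((a + g (u 0) y0) ^ 2 + n * V) =
        (a ^ 2 + n * V) * W (u 0) y0 + 2 * a * (W (u 0) y0 * g (u 0) y0) +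
          W (u 0) y0 * g (u 0) y0 ^ 2 := by intro y0; ring
    rw [Finset.sum_congr rfl fun y _ => e y, Finset.sum_add_distrib, Finset.sum_add_distrib,
      ← Finset.mul_sum, ← Finset.mul_sum, hg, (hW (u 0)).2]
    have := hV (u 0)
    push_cast
    linarith

lemma mul_log_sq_le (w : ℝ) (h0 : 0 ≤ w) (h1 : w ≤ 1) : w * Real.log w ^ 2 ≤ 4 := by
  rcases h0.eq_or_lt with rfl | hp
  · simp
  have hs : 0 < Real.sqrt w := Real.sqrt_pos.2 hp
  have h := Real.abs_log_mul_self_lt (Real.sqrt w) hs (Real.sqrt_le_one.2 h1)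
  rw [Real.log_sqrt h0] at h
  have h2 : (Real.log w / 2 * Real.sqrt w) ^ 2 ≤ 1 := by
    rw [← sq_abs]
    nlinarith [abs_nonneg (Real.log w / 2 * Real.sqrt w)]
  have h3 := Real.sq_sqrt h0
  have : (Real.log w / 2 * Real.sqrt w) ^ 2 = Real.log w ^ 2 / 4 * w := by
    rw [mul_pow, h3]; ring
  linarith

lemma negEnt_bound {X Y : Type*} [Fintype Y] (W : X → Y → ℝ) (hW : ∀ x, IsDist (W x)) (x : X) :
    0 ≤ -negEnt W x ∧ -negEnt W x ≤ Fintype.card Y := by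
  unfold negEnt
  rw [← Finset.sum_neg_distrib]
  constructor
  · refine Finset.sum_nonneg fun y _ => ?_
    have := Real.log_nonpos ((hW x).1 y) (W_le_one W hW x y)
    nlinarith [(hW x).1 y]
  · have : ∀ y, -(W x y * Real.log (W x y)) ≤ 1 := by
      intro y
      rcases ((hW x).1 y).eq_or_lt with h | h
      · rw [← h]; simp
      · have := Real.abs_log_mul_self_lt (W x y) h (W_le_one W hW x y)
        rw [abs_lt] at this
        linarith
    refine (Finset.sum_le_sum fun y _ => this y).trans ?_
    simp

lemma variance_bound {X Y : Type*} [Fintype Y] (W : X → Y → ℝ) (hW : ∀ x, IsDist (W x)) {n : ℕ}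
    (u : Fin n → X) :
    ∑ y, prodP W u y * (∑ i, Real.log (W (u i) (y i)) - ∑ i, negEnt W (u i)) ^ 2 ≤
      n * (4 * Fintype.card Y) := by
  have h := second_moment W hW (fun x y => Real.log (W x y) - negEnt W x) ?_ (4 * Fintype.card Y)
    ?_ n u 0
  · simpa using h
  · intro x
    simp only [mul_sub, Finset.sum_sub_distrib, ← Finset.sum_mul, (hW x).2]
    simp [negEnt]
  · intro x
    have e : ∀ y, W x y * (Real.log (W x y) - negEnt W x) ^ 2 =
      W x y * Real.log (W x y) ^ 2 - 2 * negEnt W x * (W x y * Real.log (W x y)) +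
        negEnt W x ^ 2 * W x y := by intro y; ring
    simp only [e]
    rw [Finset.sum_add_distrib, Finset.sum_sub_distrib, ← Finset.mul_sum, ← Finset.mul_sum,
      (hW x).2]
    have h4 : ∑ y, W x y * Real.log (W x y) ^ 2 ≤ 4 * Fintype.card Y := by
      refine (Finset.sum_le_sum fun y _ =>
        mul_log_sq_le _ ((hW x).1 y) (W_le_one W hW x y)).trans ?_
      simp [mul_comm]
    change _ - 2 * negEnt W x * negEnt W x + _ ≤ _
    nlinarith [sq_nonneg (negEnt W x)]

open Classical in
/-- The entropy-typical set. -/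
noncomputable def typ {X Y : Type*} [Fintype Y] (W : X → Y → ℝ) {n : ℕ} (c : ℝ)
    (u : Fin n → X) : Finset (Fin n → Y) :=
  Finset.univ.filter fun y => 0 < prodP W u y ∧
    |Real.log (prodP W u y) - ∑ i, negEnt W (u i)| ≤ c * Real.sqrt n

lemma typ_compl {X Y : Type*} [Fintype Y] (W : X → Y → ℝ) (hW : ∀ x, IsDist (W x)) {n : ℕ}
    (hn : 1 ≤ n) (c : ℝ) (hc : 0 < c) (u : Fin n → X) (F : Finset (Fin n → Y))
    (hF : ∀ y ∈ F, y ∉ typ W c u) :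
    probOf W u F ≤ 4 * Fintype.card Y / c ^ 2 := by
  have hn' : (0 : ℝ) < n := by exact_mod_cast hn
  have key : ∀ y ∈ F, prodP W u y ≤ (prodP W u y *
      (∑ i, Real.log (W (u i) (y i)) - ∑ i, negEnt W (u i)) ^ 2) / (c ^ 2 * n) := by
    intro y hy
    have := hF y hy
    simp only [typ, Finset.mem_filter, Finset.mem_univ, true_and, not_and, not_le] at this
    rcases (prodP_nonneg W hW u y).eq_or_lt with h | h
    · rw [← h]; simp
    · have h3 := this h
      have hl : Real.log (prodP W u y) = ∑ i, Real.log (W (u i) (y i)) := by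
        unfold prodP
        refine Real.log_prod fun i _ => ?_
        intro h0
        apply h.ne'
        exact Finset.prod_eq_zero (Finset.mem_univ i) h0
      rw [hl] at h3
      rw [le_div_iff₀ (by positivity)]
      apply mul_le_mul_of_nonneg_left _ h.le
      rw [← sq_abs (_ - _)]
      calc c ^ 2 * n = (c * Real.sqrt n) ^ 2 := by rw [mul_pow, Real.sq_sqrt hn'.le]
        _ ≤ _ := by gcongr
  unfold probOf
  refine (Finset.sum_le_sum key).trans ?_
  rw [← Finset.sum_div]
  have h5 : ∑ y ∈ F, prodP W u y *
      (∑ i, Real.log (W (u i) (y i)) - ∑ i, negEnt W (u i)) ^ 2 ≤ n * (4 * Fintype.card Y) := by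
    refine le_trans ?_ (variance_bound W hW u)
    exact Finset.sum_le_sum_of_subset_of_nonneg (Finset.subset_univ _)
      fun y _ _ => mul_nonneg (prodP_nonneg W hW u y) (sq_nonneg _)
  rw [div_le_div_iff₀ (by positivity) (by positivity)]
  nlinarith [sq_nonneg c, mul_le_mul_of_nonneg_right h5 (sq_nonneg c)]

lemma typ_prob {X Y : Type*} [Fintype Y] (W : X → Y → ℝ) (hW : ∀ x, IsDist (W x)) {n : ℕ}
    (hn : 1 ≤ n) (c : ℝ) (hc : 0 < c) (u : Fin n → X) :
    1 - 4 * Fintype.card Y / c ^ 2 ≤ probOf W u (typ W c u) := by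
  classical
  have h := typ_compl W hW hn c hc u (typ W c u)ᶜ (fun y hy => Finset.mem_compl.1 hy)
  have h2 := prodP_sum W hW u
  rw [← Finset.sum_add_sum_compl (typ W c u)] at h2
  unfold probOf at *
  linarith

lemma typ_cross {X Y : Type*} [Fintype Y] (W : X → Y → ℝ) (hW : ∀ x, IsDist (W x)) {n : ℕ}
    (hn : 1 ≤ n) (c : ℝ) (hc : 0 < c) (u v : Fin n → X)
    (huv : |∑ i, negEnt W (u i) - ∑ i, negEnt W (v i)| ≤ Real.sqrt n) :
    probOf W u (typ W c v) ≤ 4 * Fintype.card Y / c ^ 2 +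
      Real.exp ((2 * c + 1) * Real.sqrt n / 2) * ∏ i, bc W (u i) (v i) := by
  classical
  have hsplit : probOf W u (typ W c v) =
      probOf W u (typ W c v \ typ W c u) + probOf W u (typ W c v ∩ typ W c u) := by
    unfold probOf
    rw [add_comm]
    exact (Finset.sum_inter_add_sum_sdiff _ _ _).symm
  rw [hsplit]
  gcongr ?_ + ?_
  · exact typ_compl W hW hn c hc u _ fun y hy => (Finset.mem_sdiff.1 hy).2
  · rw [← prodP_bc W hW, Finset.mul_sum]
    unfold probOf
    refine le_trans (Finset.sum_le_sum (g := fun y => Real.exp ((2 * c + 1) * Real.sqrt n / 2) *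
      (Real.sqrt (prodP W u y) * Real.sqrt (prodP W v y))) ?_)
      (Finset.sum_le_sum_of_subset_of_nonneg (Finset.subset_univ _) fun _ _ _ => by positivity)
    intro y hy
    obtain ⟨hv, hu⟩ := Finset.mem_inter.1 hy
    simp only [typ, Finset.mem_filter, Finset.mem_univ, true_and] at hu hv
    obtain ⟨pu, hu⟩ := hu
    obtain ⟨pv, hv⟩ := hv
    rw [abs_le] at hu hv huv
    have h1 : Real.log (prodP W u y) ≤ (2 * c + 1) * Real.sqrt n + Real.log (prodP W v y) := by
      linarith [hu.1, hu.2, hv.1, hv.2, huv.1, huv.2]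
    have h2 : Real.sqrt (prodP W u y) ≤
        Real.exp ((2 * c + 1) * Real.sqrt n / 2) * Real.sqrt (prodP W v y) := by
      have su := Real.sqrt_pos.2 pu
      have sv := Real.sqrt_pos.2 pv
      rw [← Real.exp_log su, ← Real.exp_log sv, ← Real.exp_add, Real.exp_le_exp,
        Real.log_sqrt pu.le, Real.log_sqrt pv.le]
      linarith
    calc prodP W u y = Real.sqrt (prodP W u y) * Real.sqrt (prodP W u y) :=
          (Real.mul_self_sqrt pu.le).symm
      _ ≤ Real.sqrt (prodP W u y) *
          (Real.exp ((2 * c + 1) * Real.sqrt n / 2) * Real.sqrt (prodP W v y)) := by gcongr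
      _ = _ := by ring


lemma ball_card {X : Type*} [DecidableEq X] (A : Finset X) (hA : 1 ≤ A.card) (n k : ℕ)
    (c : Fin n → X) :
    ((Fintype.piFinset fun _ : Fin n => A).filter fun y => hammingDist c y ≤ k).card ≤
      2 ^ n * A.card ^ k := by
  have hsub : ((Fintype.piFinset fun _ : Fin n => A).filter fun y => hammingDist c y ≤ k) ⊆
      ((Finset.univ : Finset (Finset (Fin n))).filter fun D => D.card ≤ k).biUnion
        fun D => Fintype.piFinset fun i => if i ∈ D then A else {c i} := by
    intro y hy
    rw [Finset.mem_filter, Fintype.mem_piFinset] at hy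
    rw [Finset.mem_biUnion]
    refine ⟨Finset.univ.filter fun i => c i ≠ y i, ?_, ?_⟩
    · rw [Finset.mem_filter]
      exact ⟨Finset.mem_univ _, hy.2⟩
    · rw [Fintype.mem_piFinset]
      intro i
      by_cases h : c i = y i
      · simp [h]
      · simp [h, hy.1 i]
  refine (Finset.card_le_card hsub).trans ?_
  refine (Finset.card_biUnion_le_card_mul _ _ (A.card ^ k) ?_).trans ?_
  · intro D hD
    rw [Finset.mem_filter] at hD
    rw [Fintype.card_piFinset]
    have : ∀ i, (if i ∈ D then A else {c i}).card = if i ∈ D then A.card else 1 := by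
      intro i; split_ifs <;> simp
    rw [Finset.prod_congr rfl fun i _ => this i, Finset.prod_ite]
    simp only [Finset.prod_const, one_pow, mul_one, Finset.filter_mem_eq_inter,
      Finset.univ_inter]
    exact Nat.pow_le_pow_right hA hD.2
  · gcongr
    refine (Finset.card_filter_le _ _).trans ?_
    simp

lemma prod_bc_le {X Y : Type*} [Fintype Y] [DecidableEq X] (W : X → Y → ℝ)
    (hW : ∀ x, IsDist (W x)) {n : ℕ}
    (A : Finset X) (δ : ℝ) (hδ : 0 < δ)
    (hA : ∀ a ∈ A, ∀ b ∈ A, a ≠ b → δ < dist (sv W a) (sv W b)) (u v : Fin n → X)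
    (hu : ∀ i, u i ∈ A) (hv : ∀ i, v i ∈ A) (k : ℕ) (hk : k < hammingDist u v) :
    ∏ i, bc W (u i) (v i) ≤ Real.exp (-((k + 1) * δ ^ 2 / 2)) := by
  have h1 : ∀ i, bc W (u i) (v i) ≤ if u i ≠ v i then Real.exp (-(δ ^ 2 / 2)) else 1 := by
    intro i
    rw [bc_eq W hW]
    split_ifs with h
    · have h2 := hA _ (hu i) _ (hv i) h
      have h3 : δ ^ 2 < dist (sv W (u i)) (sv W (v i)) ^ 2 := by gcongr
      have h4 := Real.add_one_le_exp (-(δ ^ 2 / 2))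
      linarith
    · have := sq_nonneg (dist (sv W (u i)) (sv W (v i)))
      linarith
  refine (Finset.prod_le_prod (fun i _ => bc_nonneg W _ _) fun i _ => h1 i).trans ?_
  rw [Finset.prod_ite]
  simp only [Finset.prod_const, one_pow, mul_one]
  rw [← Real.exp_nat_mul, Real.exp_le_exp]
  have : ((k + 1 : ℕ) : ℝ) ≤ ((Finset.univ.filter fun i => u i ≠ v i).card : ℝ) := by
    exact_mod_cast hk
  push_cast at this
  nlinarith [sq_nonneg δ]

lemma achieve {X Y : Type*} [Fintype Y] (W : X → Y → ℝ) (hW : ∀ x, IsDist (W x))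
    (l1 l2 : ℝ) (n k : ℕ) (hn : 1 ≤ n) (A : Finset X) (hA1 : 1 ≤ A.card) (δ : ℝ) (hδ : 0 < δ)
    (hA : ∀ a ∈ A, ∀ b ∈ A, a ≠ b → δ < dist (sv W a) (sv W b))
    (c : ℝ) (hc : 0 < c) (hc1 : 4 * Fintype.card Y / c ^ 2 ≤ l1)
    (hc2 : 4 * Fintype.card Y / c ^ 2 ≤ l2 / 2)
    (hc3 : Real.exp ((2 * c + 1) * Real.sqrt n / 2) * Real.exp (-((k + 1) * δ ^ 2 / 2)) ≤ l2 / 2) :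
    ∃ m, diCode W n m l1 l2 ∧
      A.card ^ n ≤ m * (2 ^ n * A.card ^ k) * (Fintype.card Y * n + 1) := by
  classical
  have hn' : (1 : ℝ) ≤ n := by exact_mod_cast hn
  have hsn : 1 ≤ Real.sqrt n := Real.one_le_sqrt.2 hn'
  set S0 := Fintype.piFinset fun _ : Fin n => A with hS0
  let ent : (Fin n → X) → ℝ := fun u => ∑ i, -negEnt W (u i)
  let f : (Fin n → X) → ℕ := fun u => ⌊ent u / Real.sqrt n⌋₊
  have hent0 : ∀ u, 0 ≤ ent u := fun u => Finset.sum_nonneg fun i _ => (negEnt_bound W hW _).1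
  have hf : ∀ u ∈ S0, f u ∈ Finset.range (Fintype.card Y * n + 1) := by
    intro u _
    rw [Finset.mem_range, Nat.lt_succ_iff]
    apply Nat.floor_le_of_le
    push_cast
    refine (div_le_self (hent0 u) hsn).trans ?_
    refine (Finset.sum_le_sum fun i _ => (negEnt_bound W hW _).2).trans ?_
    simp [mul_comm]
  obtain ⟨b, hb, hmax⟩ := Finset.exists_max_image (Finset.range (Fintype.card Y * n + 1))
    (fun b => (S0.filter fun u => f u = b).card) ⟨0, by simp⟩
  set S := S0.filter fun u => f u = b with hS
  have hcardS0 : S0.card ≤ S.card * (Fintype.card Y * n + 1) := by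
    have := Finset.card_le_mul_card_image_of_maps_to hf S.card hmax
    simpa using this
  obtain ⟨s, hsS, hsep, hcov⟩ := exists_max_sep (S : Set (Fin n → X))
    (fun u v => k < hammingDist u v) S.card (fun s hs _ => Finset.card_le_card (by exact_mod_cast hs))
  have hcardS : S.card ≤ s.card * (2 ^ n * A.card ^ k) := by
    have hsub : S ⊆ s.biUnion fun c => S0.filter fun y => hammingDist c y ≤ k := by
      intro y hy
      obtain ⟨c, hcs, h⟩ := hcov y hy
      rw [Finset.mem_biUnion]
      refine ⟨c, hcs, Finset.mem_filter.2 ⟨(Finset.mem_filter.1 hy).1, ?_⟩⟩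
      rcases h with rfl | h | h
      · simp
      · exact not_lt.1 h
      · rw [hammingDist_comm]; exact not_lt.1 h
    refine (Finset.card_le_card hsub).trans ?_
    exact Finset.card_biUnion_le_card_mul _ _ _ fun c _ => ball_card A hA1 n k c
  refine ⟨s.card, ?_, ?_⟩
  · refine ⟨fun j => (s.equivFin.symm j : Fin n → X),
      fun j => typ W c (s.equivFin.symm j : Fin n → X), ?_, ?_⟩
    · intro j
      have := typ_prob W hW hn c hc (s.equivFin.symm j : Fin n → X)
      linarith
    · intro i j hij
      have hne : (s.equivFin.symm i : Fin n → X) ≠ s.equivFin.symm j := by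
        intro h
        exact hij (s.equivFin.symm.injective (Subtype.ext h))
      set u : Fin n → X := (s.equivFin.symm i).1 with hu
      set v : Fin n → X := (s.equivFin.symm j).1 with hv
      have hus : u ∈ s := (s.equivFin.symm i).2
      have hvs : v ∈ s := (s.equivFin.symm j).2
      have huS := Finset.mem_filter.1 (hsS hus)
      have hvS := Finset.mem_filter.1 (hsS hvs)
      have hen : |∑ i, negEnt W (u i) - ∑ i, negEnt W (v i)| ≤ Real.sqrt n := by
        have hfe : f u = f v := huS.2.trans hvS.2.symm
        have e1 := Nat.floor_le (div_nonneg (hent0 u) (Real.sqrt_nonneg n))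
        have e2 := Nat.lt_floor_add_one (ent u / Real.sqrt n)
        have e3 := Nat.floor_le (div_nonneg (hent0 v) (Real.sqrt_nonneg n))
        have e4 := Nat.lt_floor_add_one (ent v / Real.sqrt n)
        change ((f u : ℕ) : ℝ) ≤ _ at e1
        change _ < ((f u : ℕ) : ℝ) + 1 at e2
        change ((f v : ℕ) : ℝ) ≤ _ at e3
        change _ < ((f v : ℕ) : ℝ) + 1 at e4
        rw [hfe] at e1 e2
        rw [le_div_iff₀ (by linarith)] at e1 e3
        rw [div_lt_iff₀ (by linarith)] at e2 e4
        have eu : ent u = -∑ i, negEnt W (u i) := Finset.sum_neg_distrib _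
        have ev : ent v = -∑ i, negEnt W (v i) := Finset.sum_neg_distrib _
        rw [abs_le]
        constructor <;> nlinarith
      have h1 := typ_cross W hW hn c hc u v hen
      have h2 := prod_bc_le W hW A δ hδ hA u v (Fintype.mem_piFinset.1 huS.1)
        (Fintype.mem_piFinset.1 hvS.1) k (hsep u hus v hvs hne)
      have h3 := mul_le_mul_of_nonneg_left h2 (Real.exp_pos ((2 * c + 1) * Real.sqrt n / 2)).le
      linarith
  · have : S0.card = A.card ^ n := by simp [hS0, Fintype.card_piFinset]
    rw [← this]
    exact hcardS0.trans (Nat.mul_le_mul_right _ hcardS)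


lemma lower_log {X Y : Type*} [Fintype Y] (W : X → Y → ℝ) (hW : ∀ x, IsDist (W x))
    (l1 l2 : ℝ) (h1 : 0 < l1) (h2 : 0 < l2) (h12 : l1 + l2 < 1)
    (N : ℕ → ℕ) (hN : ∀ n, IsGreatest {m : ℕ | diCode W n m l1 l2} (N n))
    (t : ℝ) (ht : 0 < t) (ht1 : t < 1) :
    ∃ K : ℝ, 0 < K ∧ ∀ n : ℕ, 1 ≤ n → ∀ δ : ℝ, 0 < δ → δ ^ 2 = K / Real.sqrt n →
      (1 - t) * n * Real.log (cn W δ) ≤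
        Real.log (N n) + n * Real.log 2 + Real.log (Fintype.card Y * n + 1) := by
  set D : ℝ := (Fintype.card Y : ℝ) with hD
  have hD0 : 0 ≤ D := Nat.cast_nonneg _
  set μ := min l1 (l2 / 2) with hμ
  have hμ0 : 0 < μ := lt_min h1 (by linarith)
  set c := Real.sqrt (4 * D / μ) + 1 with hc
  have hc0 : 0 < c := by positivity
  have hcμ : 4 * D / c ^ 2 ≤ μ := by
    rw [div_le_iff₀ (by positivity)]
    have e : 4 * D / μ ≤ c ^ 2 := by
      have := Real.sq_sqrt (show 0 ≤ 4 * D / μ by positivity)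
      have h0 := Real.sqrt_nonneg (4 * D / μ)
      rw [hc]
      nlinarith
    rw [div_le_iff₀ hμ0] at e
    linarith
  set s := 2 * Real.log (2 / l2) with hs
  have hs0 : 0 ≤ s := by
    have : 0 ≤ Real.log (2 / l2) := Real.log_nonneg (by rw [le_div_iff₀ h2]; linarith)
    positivity
  refine ⟨(2 * c + 1 + s) / t, by positivity, ?_⟩
  intro n hn δ hδ hδn
  have hn' : (1 : ℝ) ≤ n := by exact_mod_cast hn
  have hlogN : 0 ≤ Real.log (N n) := Real.log_natCast_nonneg _
  have hlogD : 0 ≤ Real.log (D * n + 1) := Real.log_nonneg (by nlinarith)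
  have hlog2 : 0 ≤ Real.log 2 := Real.log_nonneg (by norm_num)
  obtain ⟨A, hA, hcn⟩ := cn_le_sep W hW δ hδ
  rcases Nat.eq_zero_or_pos (cn W δ) with h0 | h0
  · rw [h0]; simp; positivity
  have hA1 : 1 ≤ A.card := h0.trans_le hcn
  set k := ⌊t * n⌋₊ with hk
  have hk1 : (k : ℝ) ≤ t * n := Nat.floor_le (by positivity)
  have hk2 : t * n < k + 1 := Nat.lt_floor_add_one _
  have hsn : 1 ≤ Real.sqrt n := Real.one_le_sqrt.2 hn'
  have hsq : Real.sqrt n * Real.sqrt n = n := Real.mul_self_sqrt (by linarith)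
  obtain ⟨m, hm, hcard⟩ := achieve W hW l1 l2 n k hn A hA1 δ hδ hA c hc0
    (hcμ.trans (min_le_left _ _)) (hcμ.trans (min_le_right _ _)) (by
      rw [← Real.exp_add, ← Real.le_log_iff_exp_le (by linarith)]
      have e1 : Real.log (l2 / 2) = - (s / 2) := by
        rw [hs, show l2 / 2 = (2 / l2)⁻¹ by rw [inv_div], Real.log_inv]; ring
      rw [e1]
      have e2 : (2 * c + 1 + s) * Real.sqrt n ≤ (k + 1) * δ ^ 2 := by
        calc (2 * c + 1 + s) * Real.sqrt n = (t * n) * δ ^ 2 := by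
              rw [hδn]; field_simp; rw [Real.sq_sqrt (by linarith)]
          _ ≤ _ := by gcongr
      nlinarith)
  have hmN : m ≤ N n := (hN n).2 hm
  have hm1 : 1 ≤ m := by
    rcases Nat.eq_zero_or_pos m with h | h
    · rw [h] at hcard
      have : 0 < A.card ^ n := pow_pos hA1 n
      rw [zero_mul, zero_mul] at hcard
      omega
    · exact h
  have hAr : (1 : ℝ) ≤ A.card := by exact_mod_cast hA1
  have hmr : (1 : ℝ) ≤ m := by exact_mod_cast hm1
  have hcr : (A.card : ℝ) ^ n ≤ m * (2 ^ n * (A.card : ℝ) ^ k) * (D * n + 1) := by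
    rw [hD]; exact_mod_cast hcard
  have hl := Real.log_le_log (by positivity) hcr
  rw [Real.log_mul (by positivity) (by positivity), Real.log_mul (by positivity) (by positivity),
    Real.log_mul (by positivity) (by positivity), Real.log_pow, Real.log_pow, Real.log_pow] at hl
  have hlm : Real.log m ≤ Real.log (N n) :=
    Real.log_le_log (by positivity) (by exact_mod_cast hmN)
  have hlc : Real.log (cn W δ) ≤ Real.log A.card :=
    Real.log_le_log (by exact_mod_cast h0) (by exact_mod_cast hcn)
  have hlA : 0 ≤ Real.log A.card := Real.log_nonneg hAr
  have g1 : (1 - t) * n * Real.log (cn W δ) ≤ (1 - t) * n * Real.log A.card := by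
    apply mul_le_mul_of_nonneg_left hlc
    have : 0 < 1 - t := by linarith
    positivity
  have g2 : (k : ℝ) * Real.log A.card ≤ t * n * Real.log A.card :=
    mul_le_mul_of_nonneg_right hk1 hlA
  nlinarith

/-- The quotient whose lower limit is the dimension. -/
noncomputable def dq {X Y : Type*} [Fintype Y] (W : X → Y → ℝ) (δ : ℝ) : ℝ :=
  Real.log (cn W δ) / (-Real.log δ)

lemma dq_nonneg {X Y : Type*} [Fintype Y] (W : X → Y → ℝ) :
    ∀ᶠ δ in nhdsWithin (0 : ℝ) (Set.Ioi 0), 0 ≤ dq W δ := by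
  have h1 : Set.Ioo (0 : ℝ) 1 ∈ nhdsWithin (0 : ℝ) (Set.Ioi 0) :=
    Ioo_mem_nhdsGT (by norm_num)
  filter_upwards [h1] with δ hδ
  have := Real.log_neg hδ.1 hδ.2
  exact div_nonneg (Real.log_natCast_nonneg _) (by linarith)

lemma dq_bdd {X Y : Type*} [Fintype Y] (W : X → Y → ℝ) (hW : ∀ x, IsDist (W x)) :
    ∃ C, ∀ᶠ δ in nhdsWithin (0 : ℝ) (Set.Ioi 0), dq W δ ≤ C := by
  set D : ℝ := (Fintype.card Y : ℝ) with hD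
  have hD0 : 0 ≤ D := Nat.cast_nonneg _
  refine ⟨D * (Real.log (D + 1) + 1), ?_⟩
  have h1 : Set.Ioo (0 : ℝ) (Real.exp (-1)) ∈ nhdsWithin (0 : ℝ) (Set.Ioi 0) :=
    Ioo_mem_nhdsGT (Real.exp_pos _)
  filter_upwards [h1] with δ hδ
  have hl : 1 < -Real.log δ := by
    have := (Real.log_lt_iff_lt_exp hδ.1).2 hδ.2
    linarith
  have hδ1 : δ < 1 := hδ.2.trans (by rw [Real.exp_lt_one_iff]; norm_num)
  have hlD : 0 ≤ Real.log (D + 1) := Real.log_nonneg (by linarith)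
  unfold dq
  rw [div_le_iff₀ (by linarith)]
  rcases Nat.eq_zero_or_pos (cn W δ) with h0 | h0
  · rw [h0]; simp
    have : 0 ≤ D * (Real.log (D + 1) + 1) := by positivity
    nlinarith
  have hb : (cn W δ : ℝ) ≤ (((⌊D / δ⌋₊ + 1 : ℕ) : ℝ)) ^ Fintype.card Y := by
    exact_mod_cast cn_bound W hW δ hδ.1
  have hb2 : (((⌊D / δ⌋₊ + 1 : ℕ) : ℝ)) ≤ (D + 1) / δ := by
    push_cast
    have := Nat.floor_le (show 0 ≤ D / δ from div_nonneg hD0 hδ.1.le)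
    have : 1 ≤ 1 / δ := by rw [le_div_iff₀ hδ.1]; linarith
    rw [add_div]; linarith
  have hb3 : Real.log (cn W δ) ≤ D * (Real.log (D + 1) - Real.log δ) := by
    rw [← Real.log_div (by positivity) hδ.1.ne', hD, ← Real.log_pow]
    apply Real.log_le_log (by exact_mod_cast h0)
    refine hb.trans ?_
    gcongr
  refine hb3.trans ?_
  nlinarith [mul_nonneg hlD (show 0 ≤ -Real.log δ - 1 by linarith)]

lemma tendsto_seq (K : ℝ) (hK : 0 < K) :
    Tendsto (fun n : ℕ => Real.sqrt (K / Real.sqrt n)) atTop (nhdsWithin 0 (Set.Ioi 0)) := by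
  rw [tendsto_nhdsWithin_iff]
  constructor
  · have h1 : Tendsto (fun n : ℕ => K / Real.sqrt n) atTop (nhds 0) :=
      (tendsto_const_nhds).div_atTop (Real.tendsto_sqrt_atTop.comp tendsto_natCast_atTop_atTop)
    have h2 := (Real.continuous_sqrt.tendsto 0).comp h1
    rw [Real.sqrt_zero] at h2
    exact h2
  · filter_upwards [eventually_ge_atTop 1] with n hn
    have : (0 : ℝ) < n := by exact_mod_cast hn
    exact Real.sqrt_pos.2 (by positivity)

lemma ratio_eq (N n : ℕ) : Real.logb 2 N / ((n : ℝ) * Real.logb 2 n) =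
    Real.log N / (n * Real.log n) := by
  unfold Real.logb
  have : Real.log 2 ≠ 0 := (Real.log_pos (by norm_num)).ne'
  rw [← mul_div_assoc, div_div_div_cancel_right₀ this]

lemma const_div_log (C ε : ℝ) (hε : 0 < ε) : ∀ᶠ n : ℕ in atTop, C / Real.log n ≤ ε := by
  have h : Tendsto (fun n : ℕ => C / Real.log n) atTop (nhds 0) :=
    (tendsto_const_nhds).div_atTop (Real.tendsto_log_atTop.comp tendsto_natCast_atTop_atTop)
  filter_upwards [h.eventually (gt_mem_nhds hε)] with n hn using hn.le

lemma upper_freq {X Y : Type*} [Fintype Y] (W : X → Y → ℝ) (hW : ∀ x, IsDist (W x))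
    (l1 l2 : ℝ) (h1 : 0 < l1) (h2 : 0 < l2) (h12 : l1 + l2 < 1)
    (N : ℕ → ℕ) (hN : ∀ n, IsGreatest {m : ℕ | diCode W n m l1 l2} (N n))
    (b : ℝ) (hb0 : 0 ≤ b) (hb : ∃ᶠ δ in nhdsWithin (0 : ℝ) (Set.Ioi 0), dq W δ < b)
    (ε : ℝ) (hε : 0 < ε) :
    ∃ᶠ n : ℕ in atTop, Real.log (N n) / (n * Real.log n) ≤ b / 2 + ε := by
  set c := (1 - l1 - l2) / 5 with hc
  have hc0 : 0 < c := by rw [hc]; linarith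
  let ν : ℝ → ℕ := fun δ => ⌊(c / δ) ^ 2⌋₊
  have hν : Tendsto ν (nhdsWithin (0 : ℝ) (Set.Ioi 0)) atTop := by
    apply tendsto_nat_floor_atTop.comp
    apply (tendsto_pow_atTop (two_ne_zero)).comp
    have := tendsto_inv_nhdsGT_zero (𝕜 := ℝ)
    exact this.const_mul_atTop hc0
  have hmem : Set.Ioo (0 : ℝ) (min 1 c) ∈ nhdsWithin (0 : ℝ) (Set.Ioi 0) :=
    Ioo_mem_nhdsGT (lt_min one_pos hc0)
  set C := b * (Real.log 2 / 2 - Real.log c) with hC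
  have key : ∃ᶠ n : ℕ in atTop, 2 ≤ n → Real.log (N n) / (n * Real.log n) ≤ b / 2 + C / Real.log n := by
    apply hν.frequently
    refine (hb.and_eventually hmem).mono ?_
    rintro δ ⟨hd, hδ0, hδ1⟩ hn2
    set n := ν δ with hn
    have hδ1' : δ < 1 := hδ1.trans_le (min_le_left _ _)
    have hn1 : (1 : ℝ) < n := by exact_mod_cast hn2
    have hnle : (n : ℝ) ≤ (c / δ) ^ 2 := Nat.floor_le (by positivity)
    have hnlt : (c / δ) ^ 2 < n + 1 := Nat.lt_floor_add_one _
    have hnδ : n * δ ^ 2 ≤ c ^ 2 := by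
      rw [div_pow, le_div_iff₀ (by positivity)] at hnle
      exact hnle
    have hconv := converse W hW l1 l2 h1 h2 h12 n (N n) (by omega) δ hδ0 (by
      have : (1 - l1 - l2) = 5 * c := by rw [hc]; ring
      rw [this]
      nlinarith [sq_pos_of_pos hc0]) (hN n).1
    have hlogn : 0 < Real.log n := Real.log_pos hn1
    have hnegl : 0 < -Real.log δ := by have := Real.log_neg hδ0 hδ1'; linarith
    have hcnl : Real.log (cn W δ) ≤ b * (-Real.log δ) := by
      unfold dq at hd
      rw [div_lt_iff₀ hnegl] at hd
      exact hd.le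
    have hNl : Real.log (N n) ≤ n * Real.log (cn W δ) := by
      rcases Nat.eq_zero_or_pos (N n) with h0 | h0
      · rw [h0]; simp
        exact mul_nonneg (by linarith) (Real.log_natCast_nonneg _)
      · rw [← Real.log_pow]
        apply Real.log_le_log (by exact_mod_cast h0)
        exact_mod_cast hconv
    have hδl : -Real.log δ ≤ Real.log n / 2 + (Real.log 2 / 2 - Real.log c) := by
      have e1 : (c / δ) ^ 2 ≤ 2 * n := by linarith
      have e2 := Real.log_le_log (by positivity) e1
      rw [Real.log_pow, Real.log_div hc0.ne' hδ0.ne', Real.log_mul (by norm_num) (by linarith)] at e2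
      push_cast at e2
      linarith
    have hfin : Real.log (N n) ≤ n * (b * (Real.log n / 2 + (Real.log 2 / 2 - Real.log c))) := by
      refine hNl.trans ?_
      gcongr
      exact hcnl.trans (by gcongr)
    rw [div_le_iff₀ (by positivity)]
    refine hfin.trans (le_of_eq ?_)
    rw [hC]
    field_simp
  refine (key.and_eventually ((const_div_log C ε hε).and (eventually_ge_atTop 2))).mono ?_
  rintro n ⟨h, h3, h4⟩
  linarith [h h4]

lemma lower_ev {X Y : Type*} [Fintype Y] (W : X → Y → ℝ) (hW : ∀ x, IsDist (W x))
    (l1 l2 : ℝ) (h1 : 0 < l1) (h2 : 0 < l2) (h12 : l1 + l2 < 1)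
    (N : ℕ → ℕ) (hN : ∀ n, IsGreatest {m : ℕ | diCode W n m l1 l2} (N n))
    (b : ℝ) (hb : ∀ᶠ δ in nhdsWithin (0 : ℝ) (Set.Ioi 0), b < dq W δ)
    (t : ℝ) (ht : 0 < t) (ht1 : t < 1) (ε : ℝ) (hε : 0 < ε) :
    ∀ᶠ n : ℕ in atTop, (1 - t) * b / 4 - ε ≤ Real.log (N n) / (n * Real.log n) := by
  obtain ⟨K, hK, hlow⟩ := lower_log W hW l1 l2 h1 h2 h12 N hN t ht ht1
  set D : ℝ := (Fintype.card Y : ℝ) with hD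
  have hD0 : 0 ≤ D := Nat.cast_nonneg _
  have hseq := tendsto_seq K hK
  have hmem : Set.Ioo (0 : ℝ) 1 ∈ nhdsWithin (0 : ℝ) (Set.Ioi 0) :=
    Ioo_mem_nhdsGT one_pos
  set C := (1 - t) * b * (Real.log K / 2) + Real.log 2 + D with hC
  filter_upwards [hseq.eventually hb, hseq.eventually hmem, const_div_log C ε hε,
    eventually_ge_atTop 2] with n hn1 hn2 hn3 hn4
  set δ := Real.sqrt (K / Real.sqrt n) with hδ
  have hn : (1 : ℝ) < n := by exact_mod_cast hn4
  have hlogn : 0 < Real.log n := Real.log_pos hn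
  have hsn : 0 < Real.sqrt n := Real.sqrt_pos.2 (by linarith)
  have hl := hlow n (by omega) δ hn2.1 (Real.sq_sqrt (by positivity))
  have hδl : -Real.log δ = Real.log n / 4 - Real.log K / 2 := by
    rw [hδ, Real.log_sqrt (by positivity), Real.log_div hK.ne' hsn.ne',
      Real.log_sqrt (by linarith)]
    ring
  have hnegl : 0 < -Real.log δ := by have := Real.log_neg hn2.1 hn2.2; linarith
  unfold dq at hn1
  rw [lt_div_iff₀ hnegl, hδl] at hn1
  have hlD : Real.log (D * n + 1) ≤ D * n := by
    have := Real.log_le_sub_one_of_pos (show 0 < D * n + 1 by positivity)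
    linarith
  have g1 : (1 - t) * n * (b * (Real.log n / 4 - Real.log K / 2)) ≤
      (1 - t) * n * Real.log (cn W δ) := by
    apply mul_le_mul_of_nonneg_left hn1.le
    have : 0 < 1 - t := by linarith
    positivity
  have g2 : (1 - t) * b / 4 - C / Real.log n ≤ Real.log (N n) / (n * Real.log n) := by
    rw [le_div_iff₀ (by positivity)]
    have : ((1 - t) * b / 4 - C / Real.log n) * (n * Real.log n) =
      (1 - t) * n * (b * (Real.log n / 4)) - C * n := by field_simp
    rw [this, hC]
    linarith
  linarith

end DIChannel

open DIChannel

/-- Theorem (pessimistic superexponential DI capacity bounds): for a channel `W` with finite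
output and any `λ₁,λ₂ > 0`, `λ₁+λ₂ < 1`, with `N n` the maximal DI code size,
`(1/4)·d̲_M(√X̃) ≤ liminf log₂ N(n)/(n log₂ n) ≤ (1/2)·d̲_M(√X̃)`. -/
theorem stmt12 {X Y : Type*} [Fintype Y] (W : X → Y → ℝ) (hW : ∀ x, IsDist (W x))
    (l1 l2 : ℝ) (h1 : 0 < l1) (h2 : 0 < l2) (h12 : l1 + l2 < 1)
    (N : ℕ → ℕ) (hN : ∀ n, IsGreatest {m : ℕ | diCode W n m l1 l2} (N n)) :
    (1 / 4 : ℝ) * lowerMinkDim (sqrtSet W) ≤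
        Filter.liminf (fun n : ℕ =>
          Real.logb 2 (N n) / ((n : ℝ) * Real.logb 2 n)) Filter.atTop ∧
      Filter.liminf (fun n : ℕ =>
          Real.logb 2 (N n) / ((n : ℝ) * Real.logb 2 n)) Filter.atTop ≤
        (1 / 2 : ℝ) * lowerMinkDim (sqrtSet W) := by
  have hdim : lowerMinkDim (sqrtSet W) =
      Filter.liminf (dq W) (nhdsWithin (0 : ℝ) (Set.Ioi 0)) := rfl
  set L := lowerMinkDim (sqrtSet W) with hL
  have hbelow : (nhdsWithin (0 : ℝ) (Set.Ioi 0)).IsBoundedUnder (· ≥ ·) (dq W) :=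
    ⟨0, by simpa using dq_nonneg W⟩
  obtain ⟨C, hC⟩ := dq_bdd W hW
  have hcob : (nhdsWithin (0 : ℝ) (Set.Ioi 0)).IsCoboundedUnder (· ≥ ·) (dq W) :=
    Filter.IsCoboundedUnder.of_frequently_le hC.frequently
  have hL0 : 0 ≤ L := by
    rw [hdim]
    exact le_liminf_of_le hcob (dq_nonneg W)
  simp only [ratio_eq]
  set a : ℕ → ℝ := fun n => Real.log (N n) / (n * Real.log n) with ha
  have ha0 : ∀ n, 0 ≤ a n := fun n =>
    div_nonneg (Real.log_natCast_nonneg _) (mul_nonneg (Nat.cast_nonneg _) (Real.log_natCast_nonneg _))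
  have hab : atTop.IsBoundedUnder (· ≥ ·) a := isBoundedUnder_of ⟨0, ha0⟩
  have hfr : ∀ ε : ℝ, 0 < ε → ∃ᶠ n : ℕ in atTop, a n ≤ (L + ε) / 2 + ε := by
    intro ε hε
    refine upper_freq W hW l1 l2 h1 h2 h12 N hN (L + ε) (by linarith) ?_ ε hε
    exact frequently_lt_of_liminf_lt hcob (by rw [← hdim]; linarith)
  have hac : atTop.IsCoboundedUnder (· ≥ ·) a :=
    Filter.IsCoboundedUnder.of_frequently_le (hfr 1 one_pos)
  constructor
  · have hlow : ∀ ε ∈ Set.Ioo (0 : ℝ) 1, (1 - ε) * (L - ε) / 4 - ε ≤ liminf a atTop := by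
      intro ε hε
      apply le_liminf_of_le hac
      refine lower_ev W hW l1 l2 h1 h2 h12 N hN (L - ε) ?_ ε hε.1 hε.2 ε hε.1
      exact eventually_lt_of_lt_liminf (by rw [← hdim]; linarith [hε.1]) hbelow
    have hcont : Tendsto (fun ε : ℝ => (1 - ε) * (L - ε) / 4 - ε) (nhdsWithin 0 (Set.Ioi 0))
        (nhds ((1 - 0) * (L - 0) / 4 - 0)) := by
      apply Tendsto.mono_left _ nhdsWithin_le_nhds
      exact Continuous.tendsto (by fun_prop) 0
    have := le_of_tendsto hcont (by
      filter_upwards [Ioo_mem_nhdsGT (one_pos (α := ℝ))] with ε hε using hlow ε hε)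
    linarith
  · apply le_of_forall_pos_le_add
    intro ε hε
    have := liminf_le_of_frequently_le (hfr (ε / 2) (by linarith)) hab
    linarith
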